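/- For all jointless unlabeled graphs G, H ∈ Ĝ₀ of finite norm, d(G, H) = Σ_{n=1}^∞ |code(G)(n) − code(H)(n)|, i.e. the code map is an isometry of Ĝ₀ into ℓ¹. -/

import Mathlib

open scoped ENNReal
open Filter Topology

/-- Edges: 2-element subsets of the vertex set `ℕ`. -/
abbrev Edge : Type := {e : Sym2 ℕ // ¬ e.IsDiag}

/-- A labeled graph: an assignment of a real weight to each edge. -/
abbrev LGraph : Type := Edge → ℝ

/-- The norm of a labeled graph: the sum of the absolute values of its edge weights. -/
noncomputable def gnorm (w : LGraph) : ℝ≥0∞ := ∑' e : Edge, ENNReal.ofReal |w e|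

/-- A labeled graph has finite norm if its norm is finite. -/
def FiniteNorm (w : LGraph) : Prop := gnorm w ≠ ⊤

/-- The distance between two labeled graphs: `d(w,w') = |w - w'|`. -/
noncomputable def ldist (w w' : LGraph) : ℝ≥0∞ := ∑' e : Edge, ENNReal.ofReal |w e - w' e|

/-- A vertex is isolated if every edge containing it has weight `0`. -/
def Isolated (w : LGraph) (v : ℕ) : Prop := ∀ e : Edge, v ∈ e.val → w e = 0

/-- A labeled graph is standard if it has infinitely many isolated vertices. -/
def Standard (w : LGraph) : Prop := {v : ℕ | Isolated w v}.Infinite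

/-- The image of an edge under a bijection of the vertex set. -/
def mapEdge (f : ℕ ≃ ℕ) (e : Edge) : Edge :=
  ⟨e.val.map f, fun h => e.prop ((Sym2.isDiag_map f.injective).mp h)⟩

/-- Two labeled graphs are isomorphic if some bijection of the vertices carries the
weights of one to the other: `w(uv) = w'(f(u)f(v))` for all edges `uv`. -/
def GIso (w w' : LGraph) : Prop := ∃ f : ℕ ≃ ℕ, ∀ e : Edge, w e = w' (mapEdge f e)

/-- The isomorphism class of a labeled graph (as a set of labeled graphs). -/
def cls (w : LGraph) : Set LGraph := {w' | GIso w w'}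

/-- The distance between the isomorphism classes of two labeled graphs:
`d(G,G') = inf { d(u,v) : u ∈ G, v ∈ G' }`. -/
noncomputable def Gdist (w₁ w₂ : LGraph) : ℝ≥0∞ := ⨅ u ∈ cls w₁, ⨅ v ∈ cls w₂, ldist u v

/-- A graph is jointless if no two edges of nonzero weight share a vertex. -/
def Jointless (w : LGraph) : Prop :=
  ∀ e e' : Edge, e ≠ e' → w e ≠ 0 → w e' ≠ 0 → ∀ v : ℕ, v ∈ e.val → v ∉ e'.val

open scoped Classical

/-- `delL w a` deletes (sets to `0`) one edge of weight `a` of `w` (if `a ≠ 0` and such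
an edge exists; otherwise it is `w` itself). -/
noncomputable def delL (w : LGraph) (a : ℝ) : LGraph :=
  if h : a ≠ 0 ∧ ∃ e : Edge, w e = a then Function.update w h.2.choose 0 else w

/-- The sequence of graphs `G₀ = G`, `Gₙ = del(Gₙ₋₁, f(n))` from the definition of the code. -/
noncomputable def codeIter (w : LGraph) : ℕ → LGraph
  | 0 => w
  | n + 1 =>
    delL (codeIter w n)
      (if (n + 1) % 2 = 1 then sSup (Set.range (codeIter w n))
       else sInf (Set.range (codeIter w n)))

/-- `code w n` is the `(n+1)`-st entry of the code of the graph `w`: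
`f(n+1) = max spec(Gₙ)` if `n+1` is odd, and `f(n+1) = min spec(Gₙ)` if `n+1` is even. -/
noncomputable def code (w : LGraph) (n : ℕ) : ℝ :=
  if (n + 1) % 2 = 1 then sSup (Set.range (codeIter w n)) else sInf (Set.range (codeIter w n))

open MeasureTheory

/-! ### Weights vanishing at infinity -/

/-- Only finitely many edges have weight bounded away from `0`, and some edge has weight `0`. -/
structure VanishingWeights (w : LGraph) : Prop where
  finite_le_abs : ∀ ε : ℝ, 0 < ε → {e | ε ≤ |w e|}.Finite
  exists_eq_zero : ∃ e, w e = 0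

lemma FiniteNorm.finite_le_abs {w : LGraph} (hf : FiniteNorm w) {ε : ℝ} (hε : 0 < ε) :
    {e | ε ≤ |w e|}.Finite := by
  have h := ENNReal.finite_const_le_of_tsum_ne_top (show ∑' e, ENNReal.ofReal |w e| ≠ ⊤ from hf)
    (ε := ENNReal.ofReal ε) (by simpa using hε)
  refine h.subset fun e he => ?_
  exact ENNReal.ofReal_le_ofReal he

lemma Standard.exists_eq_zero {w : LGraph} (hs : Standard w) : ∃ e, w e = 0 := by
  obtain ⟨v, hv⟩ := hs.nonempty
  exact ⟨⟨s(v, v + 1), by simp⟩, hv _ (by simp)⟩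

lemma vanishingWeights {w : LGraph} (hs : Standard w) (hf : FiniteNorm w) : VanishingWeights w :=
  ⟨fun _ hε => hf.finite_le_abs hε, hs.exists_eq_zero⟩

lemma VanishingWeights.exists_isGreatest {w : LGraph} (hw : VanishingWeights w) :
    ∃ a, IsGreatest (Set.range w) a := by
  by_cases h : ∃ e, 0 < w e
  · obtain ⟨e, he⟩ := h
    have hfin : {e' | w e ≤ w e'}.Finite :=
      (hw.finite_le_abs _ he).subset fun e' (h' : w e ≤ w e') =>
        h'.trans (le_abs_self (w e'))
    obtain ⟨m, hm, hmax⟩ := Set.exists_max_image _ w hfin ⟨e, le_refl (w e)⟩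
    refine ⟨w m, ⟨m, rfl⟩, ?_⟩
    rintro _ ⟨e', rfl⟩
    rcases le_total (w e) (w e') with h' | h'
    · exact hmax e' h'
    · exact h'.trans hm
  · push Not at h
    obtain ⟨e, he⟩ := hw.exists_eq_zero
    refine ⟨0, ⟨e, he⟩, ?_⟩
    rintro _ ⟨e', rfl⟩
    exact h e'

lemma VanishingWeights.neg {w : LGraph} (hw : VanishingWeights w) : VanishingWeights (-w) :=
  ⟨fun ε hε => by simpa using hw.finite_le_abs ε hε, by simpa using hw.exists_eq_zero⟩

lemma VanishingWeights.isGreatest_sSup {w : LGraph} (hw : VanishingWeights w) :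
    IsGreatest (Set.range w) (sSup (Set.range w)) := by
  obtain ⟨a, ha⟩ := hw.exists_isGreatest
  rwa [ha.csSup_eq]

lemma VanishingWeights.isLeast_sInf {w : LGraph} (hw : VanishingWeights w) :
    IsLeast (Set.range w) (sInf (Set.range w)) := by
  obtain ⟨a, ⟨e, rfl⟩, ha⟩ := hw.neg.exists_isGreatest
  have h : IsLeast (Set.range w) (w e) := by
    refine ⟨⟨e, rfl⟩, ?_⟩
    rintro _ ⟨e', rfl⟩
    simpa using ha ⟨e', rfl⟩
  rwa [h.csInf_eq]

/-! ### Deleting edges -/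

lemma delL_eq_or_eq_zero (w : LGraph) (a : ℝ) (e : Edge) : delL w a e = w e ∨ delL w a e = 0 := by
  unfold delL
  split_ifs with h
  · by_cases he : e = h.2.choose
    · right; rw [he, Function.update_self]
    · left; rw [Function.update_of_ne he]
  · exact Or.inl rfl

lemma exists_delL_eq_update {w : LGraph} {a : ℝ} (ha : a ≠ 0) (h : ∃ e, w e = a) :
    ∃ e, w e = a ∧ delL w a = Function.update w e 0 :=
  ⟨h.choose, h.choose_spec, by rw [delL, dif_pos ⟨ha, h⟩]⟩

lemma codeIter_eq_or_eq_zero (w : LGraph) {m n : ℕ} (h : m ≤ n) (e : Edge) :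
    codeIter w n e = codeIter w m e ∨ codeIter w n e = 0 := by
  induction n, h using Nat.le_induction with
  | base => exact Or.inl rfl
  | succ n _ ih =>
    rcases delL_eq_or_eq_zero (codeIter w n) (code w n) e with h | h
    · rcases ih with h' | h'
      · exact Or.inl (h.trans h')
      · exact Or.inr (h.trans h')
    · exact Or.inr h

variable {w : LGraph}

lemma VanishingWeights.iter (hw : VanishingWeights w) (n : ℕ) :
    VanishingWeights (codeIter w n) := by
  refine ⟨fun ε hε => (hw.finite_le_abs ε hε).subset fun e he => ?_, ?_⟩
  · rcases codeIter_eq_or_eq_zero w n.zero_le e with h | h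
    · rw [Set.mem_ofPred_eq, h] at he
      exact he
    · rw [Set.mem_ofPred_eq, h, abs_zero] at he
      exact absurd he (not_le.mpr hε)
  · obtain ⟨e, he⟩ := hw.exists_eq_zero
    refine ⟨e, ?_⟩
    rcases codeIter_eq_or_eq_zero w n.zero_le e with h | h
    · exact h.trans he
    · exact h

lemma VanishingWeights.sSup_nonneg (hw : VanishingWeights w) : 0 ≤ sSup (Set.range w) :=
  hw.isGreatest_sSup.2 hw.exists_eq_zero

lemma VanishingWeights.sInf_nonpos (hw : VanishingWeights w) : sInf (Set.range w) ≤ 0 :=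
  hw.isLeast_sInf.2 hw.exists_eq_zero

lemma VanishingWeights.sSup_codeIter_anti (hw : VanishingWeights w) {m n : ℕ} (h : m ≤ n) :
    sSup (Set.range (codeIter w n)) ≤ sSup (Set.range (codeIter w m)) := by
  obtain ⟨e, he⟩ := (hw.iter n).isGreatest_sSup.1
  rw [← he]
  rcases codeIter_eq_or_eq_zero w h e with h' | h'
  · rw [h']
    exact (hw.iter m).isGreatest_sSup.2 ⟨e, rfl⟩
  · rw [h']
    exact (hw.iter m).sSup_nonneg

lemma VanishingWeights.sInf_codeIter_mono (hw : VanishingWeights w) {m n : ℕ} (h : m ≤ n) :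
    sInf (Set.range (codeIter w m)) ≤ sInf (Set.range (codeIter w n)) := by
  obtain ⟨e, he⟩ := (hw.iter n).isLeast_sInf.1
  rw [← he]
  rcases codeIter_eq_or_eq_zero w h e with h' | h'
  · rw [h']
    exact (hw.iter m).isLeast_sInf.2 ⟨e, rfl⟩
  · rw [h']
    exact (hw.iter m).sInf_nonpos

/-! ### The entries of the code -/

lemma code_of_even {n : ℕ} (h : n % 2 = 0) : code w n = sSup (Set.range (codeIter w n)) := by
  rw [code, if_pos (by omega)]

lemma code_of_odd {n : ℕ} (h : n % 2 = 1) : code w n = sInf (Set.range (codeIter w n)) := by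
  rw [code, if_neg (by omega)]

lemma VanishingWeights.code_nonneg (hw : VanishingWeights w) {n : ℕ} (h : n % 2 = 0) :
    0 ≤ code w n := by
  rw [code_of_even h]
  exact (hw.iter n).sSup_nonneg

lemma VanishingWeights.code_nonpos (hw : VanishingWeights w) {n : ℕ} (h : n % 2 = 1) :
    code w n ≤ 0 := by
  rw [code_of_odd h]
  exact (hw.iter n).sInf_nonpos

lemma VanishingWeights.code_mem_range (hw : VanishingWeights w) (n : ℕ) :
    ∃ e, codeIter w n e = code w n := by
  rcases Nat.mod_two_eq_zero_or_one n with h | h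
  · rw [code_of_even h]
    exact (hw.iter n).isGreatest_sSup.1
  · rw [code_of_odd h]
    exact (hw.iter n).isLeast_sInf.1

/-- `φ` lists the nonzero weights of `u` in the order prescribed by the sequence `c`. -/
structure Enumerates (φ : ℕ → Edge) (c : ℕ → ℝ) (u : LGraph) : Prop where
  injOn : Set.InjOn φ {n | c n ≠ 0}
  apply_eq : ∀ n, c n ≠ 0 → u (φ n) = c n
  exists_of_ne_zero : ∀ e, u e ≠ 0 → ∃ n, c n ≠ 0 ∧ φ n = e

lemma VanishingWeights.exists_enumerates (hw : VanishingWeights w) :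
    ∃ φ, Enumerates φ (code w) w := by
  have key : ∀ n, ∃ e, code w n ≠ 0 → codeIter w n e = code w n ∧
      codeIter w (n + 1) = Function.update (codeIter w n) e 0 := by
    intro n
    by_cases h : code w n = 0
    · obtain ⟨e, -⟩ := hw.exists_eq_zero
      exact ⟨e, fun h' => absurd h h'⟩
    · obtain ⟨e, he⟩ := exists_delL_eq_update h (hw.code_mem_range n)
      exact ⟨e, fun _ => he⟩
  choose φ hφ using key
  have happ : ∀ n, code w n ≠ 0 → w (φ n) = code w n := by
    intro n hn
    have h := (hφ n hn).1
    rcases codeIter_eq_or_eq_zero w n.zero_le (φ n) with h' | h'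
    · exact h'.symm.trans h
    · exact absurd (h.symm.trans h') hn
  have hlt : ∀ m n, m < n → code w m ≠ 0 → code w n ≠ 0 → φ m ≠ φ n := by
    intro m n hmn hm hn heq
    have h0 : codeIter w (m + 1) (φ n) = 0 := by
      rw [(hφ m hm).2, ← heq, Function.update_self]
    have h1 := (hφ n hn).1
    rcases codeIter_eq_or_eq_zero w (show m + 1 ≤ n from hmn) (φ n) with h | h
    · exact hn (h1.symm.trans (h.trans h0))
    · exact hn (h1.symm.trans h)
  have hinj : Set.InjOn φ {n | code w n ≠ 0} := by
    intro m hm n hn heq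
    rcases lt_trichotomy m n with h | h | h
    · exact absurd heq (hlt m n h hm hn)
    · exact h
    · exact absurd heq.symm (hlt n m h hn hm)
  refine ⟨φ, hinj, happ, fun e he => ?_⟩
  by_contra! hne
  have hkeep : ∀ n, codeIter w n e = w e := by
    intro n
    induction n with
    | zero => rfl
    | succ n ih =>
      by_cases hc : code w n = 0
      · have : codeIter w (n + 1) = codeIter w n := by
          change delL (codeIter w n) (code w n) = _
          rw [delL, dif_neg (fun h => h.1 hc)]
        rw [this, ih]
      · rw [(hφ n hc).2, Function.update_of_ne (hne n hc).symm, ih]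
  have hbig : ∃ r, ∀ k, |w e| ≤ |code w (2 * k + r)| := by
    rcases lt_or_gt_of_ne he with h | h
    · refine ⟨1, fun k => ?_⟩
      have hle : code w (2 * k + 1) ≤ w e := by
        rw [code_of_odd (by omega)]
        exact (hw.iter _).isLeast_sInf.2 ⟨e, hkeep _⟩
      rw [abs_of_neg h, abs_of_neg (hle.trans_lt h)]
      linarith
    · refine ⟨0, fun k => ?_⟩
      have hle : w e ≤ code w (2 * k + 0) := by
        rw [code_of_even (by omega)]
        exact (hw.iter _).isGreatest_sSup.2 ⟨e, hkeep _⟩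
      rw [abs_of_pos h, abs_of_pos (h.trans_le hle)]
      exact hle
  obtain ⟨r, hr⟩ := hbig
  have hpos : 0 < |w e| := abs_pos.mpr he
  have hcne : ∀ k, code w (2 * k + r) ≠ 0 := fun k => abs_pos.mp (hpos.trans_le (hr k))
  refine Set.infinite_of_injective_forall_mem (f := fun k => φ (2 * k + r)) ?_ ?_
    (hw.finite_le_abs _ hpos)
  · intro j k hjk
    have := hinj (hcne j) (hcne k) hjk
    omega
  · intro k
    change |w e| ≤ |w (φ (2 * k + r))|
    rw [happ _ (hcne k)]
    exact hr k

/-! ### Isomorphisms -/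

lemma mapEdge_injective (f : ℕ ≃ ℕ) : Function.Injective (mapEdge f) := fun _ _ h =>
  Subtype.ext (Sym2.map.injective f.injective (congrArg Subtype.val h))

lemma mapEdge_symm_apply (f : ℕ ≃ ℕ) (e : Edge) : mapEdge f (mapEdge f.symm e) = e :=
  Subtype.ext (by simp [mapEdge, Sym2.map_map])

lemma GIso.symm {u v : LGraph} (h : GIso u v) : GIso v u := by
  obtain ⟨f, hf⟩ := h
  exact ⟨f.symm, fun e => by rw [hf, mapEdge_symm_apply]⟩

lemma Enumerates.of_gIso {φ : ℕ → Edge} {c : ℕ → ℝ} {u v : LGraph} (hφ : Enumerates φ c u)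
    (h : GIso u v) : ∃ ψ, Enumerates ψ c v := by
  obtain ⟨f, hf⟩ := h
  refine ⟨fun n => mapEdge f (φ n), ?_, ?_, ?_⟩
  · exact fun m hm n hn h => hφ.injOn hm hn (mapEdge_injective f h)
  · exact fun n hn => by rw [← hf, hφ.apply_eq n hn]
  · intro e he
    obtain ⟨n, hn, hne⟩ := hφ.exists_of_ne_zero (mapEdge f.symm e)
      (by rwa [hf, mapEdge_symm_apply])
    exact ⟨n, hn, by rw [hne, mapEdge_symm_apply]⟩

/-- An injection defined on a coinfinite set of natural numbers and with coinfinite image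
extends to a permutation. -/
lemma Set.InjOn.exists_perm_nat {T : Set ℕ} {h : ℕ → ℕ} (hinj : Set.InjOn h T)
    (hT : Tᶜ.Infinite) (hS : (h '' T)ᶜ.Infinite) : ∃ f : ℕ ≃ ℕ, ∀ x ∈ T, f x = h x := by
  have := hT.to_subtype
  have := hS.to_subtype
  obtain ⟨g⟩ : Nonempty (↥(Tᶜ) ≃ ↥((h '' T)ᶜ)) := nonempty_equiv_of_countable
  refine ⟨(Equiv.Set.sumCompl T).symm.trans
    ((Equiv.sumCongr (Equiv.Set.imageOfInjOn h T hinj) g).trans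
      (Equiv.Set.sumCompl (h '' T))), fun x hx => ?_⟩
  simp [Equiv.Set.sumCompl_symm_apply_of_mem hx, Equiv.Set.imageOfInjOn]

/-- A matching of `ℕ` missing infinitely many vertices. -/
def matchEdge (n : ℕ) : Edge := ⟨s(3 * n, 3 * n + 1), by simp⟩

lemma matchEdge_injective : Function.Injective matchEdge := by
  intro m n h
  have := congrArg Subtype.val h
  simp only [matchEdge, Sym2.eq_iff] at this
  omega

/-- The jointless graph carrying the weights `c` along the edges `matchEdge`. -/
noncomputable def matchGraph (c : ℕ → ℝ) : LGraph := Function.extend matchEdge c fun _ => 0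

lemma matchGraph_matchEdge (c : ℕ → ℝ) (n : ℕ) : matchGraph c (matchEdge n) = c n :=
  matchEdge_injective.extend_apply c _ n

lemma matchGraph_of_notMem (c : ℕ → ℝ) {e : Edge} (he : ¬ ∃ n, matchEdge n = e) :
    matchGraph c e = 0 :=
  Function.extend_apply' c _ e he

lemma ldist_matchGraph (c c' : ℕ → ℝ) :
    ldist (matchGraph c) (matchGraph c') = ∑' n, ENNReal.ofReal |c n - c' n| := by
  rw [ldist, ← matchEdge_injective.tsum_eq]
  · simp [matchGraph_matchEdge]
  · intro e he
    by_contra hne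
    exact he (by simp [matchGraph_of_notMem _ hne])

lemma Enumerates.gIso_matchGraph {φ : ℕ → Edge} {c : ℕ → ℝ} (hφ : Enumerates φ c w)
    (hs : Standard w) (hj : Jointless w) : GIso w (matchGraph c) := by
  have hends : ∀ n, ∃ a b, (φ n).val = s(a, b) := fun n =>
    Sym2.ind (f := fun z => ∃ a b, z = s(a, b)) (fun a b => ⟨a, b, rfl⟩) (φ n).val
  choose a b hab using hends
  have hne : ∀ n, a n ≠ b n := fun n h => (φ n).prop (by rw [hab, h]; simp)
  have hdisj : ∀ m n, c m ≠ 0 → c n ≠ 0 → ∀ v, v ∈ (φ m).val → v ∈ (φ n).val → m = n := by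
    intro m n hm hn v hvm hvn
    by_contra hmn
    exact hj (φ m) (φ n) (fun h => hmn (hφ.injOn hm hn h)) (by rwa [hφ.apply_eq m hm])
      (by rwa [hφ.apply_eq n hn]) v hvm hvn
  let h : ℕ → ℕ := fun x => if x % 3 = 0 then a (x / 3) else b (x / 3)
  let T : Set ℕ := {x | x % 3 ≠ 2 ∧ c (x / 3) ≠ 0}
  have hmem : ∀ x, h x ∈ (φ (x / 3)).val := by
    intro x
    rw [hab]
    by_cases hx : x % 3 = 0 <;> simp [h, hx]
  have hinj : Set.InjOn h T := by
    intro x hx y hy hxy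
    have hdiv := hdisj _ _ hx.2 hy.2 (h x) (hmem x) (hxy ▸ hmem y)
    have hx2 := hx.1
    have hy2 := hy.1
    have hab' := hne (y / 3)
    simp only [h, hdiv] at hxy
    split_ifs at hxy with h1 h2 h2
    · omega
    · exact absurd hxy hab'
    · exact absurd hxy.symm hab'
    · omega
  have hT : Tᶜ.Infinite := by
    refine Set.infinite_of_injective_forall_mem (f := fun n => 3 * n + 2) ?_ ?_
    · intro m n hmn
      simpa using hmn
    · intro n hn
      exact hn.1 (by omega)
  have hS : (h '' T)ᶜ.Infinite := by
    refine hs.mono ?_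
    rintro v hv ⟨x, hx, rfl⟩
    exact hx.2 (by rw [← hφ.apply_eq _ hx.2, hv _ (hmem x)])
  obtain ⟨f, hf⟩ := hinj.exists_perm_nat hT hS
  have hfφ : ∀ n, c n ≠ 0 → mapEdge f (matchEdge n) = φ n := by
    intro n hn
    have e1 : 3 * n / 3 = n := by omega
    have e2 : (3 * n + 1) / 3 = n := by omega
    have e3 : 3 * n % 3 = 0 := by omega
    have e4 : (3 * n + 1) % 3 = 1 := by omega
    have h1 : f (3 * n) = a n := by
      rw [hf _ ⟨by omega, by rwa [e1]⟩]
      simp only [h, e3, e1, if_true]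
    have h2 : f (3 * n + 1) = b n := by
      rw [hf _ ⟨by omega, by rwa [e2]⟩]
      simp only [h, e4, e2, one_ne_zero, if_false]
    refine Subtype.ext ?_
    simp [mapEdge, matchEdge, hab, h1, h2]
  refine GIso.symm ⟨f, fun e => ?_⟩
  by_cases he : matchGraph c e = 0
  · rw [he]
    by_contra hw
    obtain ⟨n, hn, hne⟩ := hφ.exists_of_ne_zero _ (Ne.symm hw)
    rw [← hfφ n hn] at hne
    rw [← mapEdge_injective f hne, matchGraph_matchEdge] at he
    exact hn he
  · obtain ⟨n, rfl⟩ : ∃ n, matchEdge n = e := by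
      by_contra hne
      exact he (matchGraph_of_notMem c hne)
    rw [matchGraph_matchEdge] at he ⊢
    rw [hfφ n he, hφ.apply_eq n he]

/-! ### The layer cake formula -/

lemma ofReal_abs_sub_eq_lintegral (x y : ℝ) :
    ENNReal.ofReal |x - y| = ∫⁻ t, {t | ¬ (x ≤ t ↔ y ≤ t)}.indicator 1 t := by
  have h : {t | ¬ (x ≤ t ↔ y ≤ t)} = Set.Ico (min x y) (max x y) := by
    ext t
    simp only [Set.mem_ofPred_eq, Set.mem_Ico, min_le_iff, lt_max_iff]
    grind
  rw [h, lintegral_indicator_one measurableSet_Ico, Real.volume_Ico, max_sub_min_eq_abs']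

lemma tsum_ofReal_abs_sub_eq_lintegral {ι : Type*} [Countable ι] (u v : ι → ℝ) :
    ∑' i, ENNReal.ofReal |u i - v i| =
      ∫⁻ t, ({i | ¬ (u i ≤ t ↔ v i ≤ t)}.encard : ℝ≥0∞) := by
  simp_rw [ofReal_abs_sub_eq_lintegral]
  rw [← lintegral_tsum]
  · refine lintegral_congr fun t => ?_
    rw [← ENNReal.tsum_set_one, tsum_subtype {i | ¬ (u i ≤ t ↔ v i ≤ t)} fun _ => (1 : ℝ≥0∞)]
    refine tsum_congr fun i => ?_
    simp only [Set.indicator_apply, Set.mem_ofPred_eq, Pi.one_apply]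
  · intro i
    refine (measurable_one.indicator ?_).aemeasurable
    have : {t | ¬ (u i ≤ t ↔ v i ≤ t)} = (symmDiff (Set.Ici (u i)) (Set.Ici (v i))) := by
      ext t
      simp only [Set.mem_ofPred_eq, Set.mem_symmDiff, Set.mem_Ici]
      tauto
    rw [this]
    exact measurableSet_Ici.symmDiff measurableSet_Ici

lemma Set.encard_diff_le_of_subset {α β : Type*} {P Q : Set α} {A B : Set β} (hPQ : P ⊆ Q)
    (hP : P.Finite) (hA : A.encard = P.encard) (hB : B.encard = Q.encard) :
    (symmDiff P Q).encard ≤ (symmDiff A B).encard := by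
  have h1 : (Q \ P).encard + P.encard = Q.encard := Set.encard_sdiff_add_encard_of_subset hPQ
  have h2 : B.encard ≤ (B \ A).encard + A.encard := by
    rw [Set.encard_sdiff_add_encard]
    exact Set.encard_le_encard Set.subset_union_left
  rw [hB, ← h1, hA, ENat.add_le_add_iff_right (Set.encard_ne_top_iff.mpr hP)] at h2
  rw [symmDiff_of_le hPQ]
  exact h2.trans (Set.encard_le_encard (by simp [Set.symmDiff_def]))

lemma Set.encard_symmDiff_le_of_total {α β : Type*} {P Q : Set α} {A B : Set β}
    (hPQ : P ⊆ Q ∨ Q ⊆ P) (hP : P.Finite) (hQ : Q.Finite) (hA : A.encard = P.encard)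
    (hB : B.encard = Q.encard) : (symmDiff P Q).encard ≤ (symmDiff A B).encard := by
  rcases hPQ with h | h
  · exact Set.encard_diff_le_of_subset h hP hA hB
  · rw [symmDiff_comm P, symmDiff_comm A]
    exact Set.encard_diff_le_of_subset h hQ hB hA

lemma Enumerates.encard_eq {φ : ℕ → Edge} {c : ℕ → ℝ} (hφ : Enumerates φ c w) {p : ℝ → Prop}
    (hp : ¬ p 0) : {e | p (w e)}.encard = {n | p (c n)}.encard := by
  have hne : {n | p (c n)} ⊆ {n | c n ≠ 0} := fun n (hn : p (c n)) h => hp (h ▸ hn)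
  rw [← (hφ.injOn.mono hne).encard_image]
  congr 1
  ext e
  constructor
  · intro he
    obtain ⟨n, hn, rfl⟩ := hφ.exists_of_ne_zero e fun h => hp (h ▸ he)
    exact ⟨n, by simpa only [Set.mem_ofPred_eq, hφ.apply_eq n hn] using he, rfl⟩
  · rintro ⟨n, hn, rfl⟩
    simpa only [Set.mem_ofPred_eq, hφ.apply_eq n (hne hn)] using hn

lemma subset_or_subset_of_lower {P Q : Set ℕ} (r : ℕ) (hPr : ∀ n ∈ P, n % 2 = r)
    (hQr : ∀ n ∈ Q, n % 2 = r) (hP : ∀ n ∈ P, ∀ m ≤ n, m % 2 = r → m ∈ P)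
    (hQ : ∀ n ∈ Q, ∀ m ≤ n, m % 2 = r → m ∈ Q) : P ⊆ Q ∨ Q ⊆ P := by
  by_contra! h
  obtain ⟨⟨n, hnP, hnQ⟩, ⟨m, hmQ, hmP⟩⟩ := And.imp Set.not_subset.mp Set.not_subset.mp h
  rcases le_total m n with h | h
  · exact hmP (hP n hnP m h (hQr m hmQ))
  · exact hnQ (hQ m hmQ n h (hPr n hnP))

lemma VanishingWeights.finite_code (hw : VanishingWeights w) {p : ℝ → Prop} {ε : ℝ} (hε : 0 < ε)
    (hp : ∀ x, p x → ε ≤ |x|) : {n | p (code w n)}.Finite := by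
  obtain ⟨φ, hφ⟩ := hw.exists_enumerates
  rw [← Set.encard_ne_top_iff, ← hφ.encard_eq fun h => absurd (hp 0 h) (by simpa using hε),
    Set.encard_ne_top_iff]
  exact (hw.finite_le_abs ε hε).subset fun e he => hp _ he

lemma encard_code_le {w₁ w₂ u v : LGraph} (h₁ : VanishingWeights w₁) (h₂ : VanishingWeights w₂)
    {φ ψ : ℕ → Edge} (hφ : Enumerates φ (code w₁) u) (hψ : Enumerates ψ (code w₂) v) {t : ℝ}
    (ht : t ≠ 0) : {n | ¬ (code w₁ n ≤ t ↔ code w₂ n ≤ t)}.encard ≤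
      {e | ¬ (u e ≤ t ↔ v e ≤ t)}.encard := by
  rcases lt_or_gt_of_ne ht with ht | ht
  · have hsd : ∀ {ι : Type} (x y : ι → ℝ), {i | ¬ (x i ≤ t ↔ y i ≤ t)} =
        symmDiff {i | x i ≤ t} {i | y i ≤ t} := by
      intro ι x y
      ext i
      simp only [Set.mem_ofPred_eq, Set.mem_symmDiff]
      tauto
    have hp : ∀ x, x ≤ t → -t ≤ |x| := fun x hx => by linarith [neg_le_abs x]
    have hodd : ∀ {w : LGraph}, VanishingWeights w → ∀ n, code w n ≤ t → n % 2 = 1 := by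
      intro w hw n hn
      by_contra h
      linarith [hw.code_nonneg (n := n) (by omega)]
    have hlow : ∀ {w : LGraph}, VanishingWeights w → ∀ n, code w n ≤ t → ∀ m ≤ n, m % 2 = 1 →
        code w m ≤ t := by
      intro w hw n hn m hmn hm
      rw [code_of_odd (hodd hw n hn)] at hn
      rw [code_of_odd hm]
      exact (hw.sInf_codeIter_mono hmn).trans hn
    rw [hsd, hsd]
    exact Set.encard_symmDiff_le_of_total
      (subset_or_subset_of_lower 1 (hodd h₁) (hodd h₂) (hlow h₁) (hlow h₂))
      (h₁.finite_code (neg_pos.mpr ht) hp) (h₂.finite_code (neg_pos.mpr ht) hp)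
      (hφ.encard_eq (p := (· ≤ t)) (not_le.mpr ht)) (hψ.encard_eq (p := (· ≤ t)) (not_le.mpr ht))
  · have hsd : ∀ {ι : Type} (x y : ι → ℝ), {i | ¬ (x i ≤ t ↔ y i ≤ t)} =
        symmDiff {i | t < x i} {i | t < y i} := by
      intro ι x y
      ext i
      simp only [Set.mem_ofPred_eq, Set.mem_symmDiff, ← not_le]
      tauto
    have hp : ∀ x, t < x → t ≤ |x| := fun x hx => hx.le.trans (le_abs_self x)
    have heven : ∀ {w : LGraph}, VanishingWeights w → ∀ n, t < code w n → n % 2 = 0 := by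
      intro w hw n hn
      by_contra h
      linarith [hw.code_nonpos (n := n) (by omega)]
    have hlow : ∀ {w : LGraph}, VanishingWeights w → ∀ n, t < code w n → ∀ m ≤ n, m % 2 = 0 →
        t < code w m := by
      intro w hw n hn m hmn hm
      rw [code_of_even (heven hw n hn)] at hn
      rw [code_of_even hm]
      exact hn.trans_le (hw.sSup_codeIter_anti hmn)
    rw [hsd, hsd]
    exact Set.encard_symmDiff_le_of_total
      (subset_or_subset_of_lower 0 (heven h₁) (heven h₂) (hlow h₁) (hlow h₂))
      (h₁.finite_code ht hp) (h₂.finite_code ht hp)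
      (hφ.encard_eq (p := (t < ·)) ht.le.not_gt) (hψ.encard_eq (p := (t < ·)) ht.le.not_gt)

lemma tsum_code_le_ldist {w₁ w₂ u v : LGraph} (h₁ : VanishingWeights w₁)
    (h₂ : VanishingWeights w₂) (hu : GIso w₁ u) (hv : GIso w₂ v) :
    ∑' n, ENNReal.ofReal |code w₁ n - code w₂ n| ≤ ldist u v := by
  obtain ⟨φ, hφ⟩ := h₁.exists_enumerates.choose_spec.of_gIso hu
  obtain ⟨ψ, hψ⟩ := h₂.exists_enumerates.choose_spec.of_gIso hv
  rw [ldist, tsum_ofReal_abs_sub_eq_lintegral, tsum_ofReal_abs_sub_eq_lintegral]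
  refine lintegral_mono_ae ?_
  filter_upwards [Measure.ae_ne volume (0 : ℝ)] with t ht
  exact_mod_cast encard_code_le h₁ h₂ hφ hψ ht

/-- For jointless unlabeled graphs of finite norm, the distance is the `ℓ¹` distance
of the codes: the code map is an isometry into `ℓ¹`. -/
theorem dist_eq_code_dist (w₁ w₂ : LGraph)
    (hs₁ : Standard w₁) (hf₁ : FiniteNorm w₁) (hj₁ : Jointless w₁)
    (hs₂ : Standard w₂) (hf₂ : FiniteNorm w₂) (hj₂ : Jointless w₂) :
    Gdist w₁ w₂ = ∑' n : ℕ, ENNReal.ofReal |code w₁ n - code w₂ n| := by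
  have h₁ := vanishingWeights hs₁ hf₁
  have h₂ := vanishingWeights hs₂ hf₂
  refine le_antisymm ?_ ?_
  · rw [← ldist_matchGraph]
    exact (iInf₂_le _ (h₁.exists_enumerates.choose_spec.gIso_matchGraph hs₁ hj₁)).trans
      (iInf₂_le _ (h₂.exists_enumerates.choose_spec.gIso_matchGraph hs₂ hj₂))
  · exact le_iInf₂ fun u hu => le_iInf₂ fun v hv => tsum_code_le_ldist h₁ h₂ hu hv
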